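/- Fix an integer n ≥ 2. Then #{ f ∈ 𝒫⁰_{n,N} : D_{ℚ_f} ≤ N^{1/√(log log N)} } / |𝒫⁰_{n,N}| → 0 as N → ∞; that is, the density within 𝒫⁰_{n,N} of polynomials whose field ℚ_f has absolute discriminant at most N^{1/√(log log N)} tends to zero. -/

import Mathlib

/-!
Arithmetic statistics of families of integer `S_n`-polynomials (I. Viglino).

`𝒫_{n,N}` is the family of monic integer polynomials
`f(X) = X^n + a_{n-1}X^{n-1} + ⋯ + a_0` with `|a_i| ≤ N`, identified with their
coefficient vectors `a : Fin n → ℤ`, and `𝒫⁰_{n,N} ⊆ 𝒫_{n,N}` is the subfamily of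
`f` whose splitting field over `ℚ` has Galois group isomorphic to `S_n`.
-/

open Polynomial Finset Filter

attribute [local instance] Classical.propDecidable

noncomputable section

/-- The monic integer polynomial `X^n + a_{n-1}X^{n-1} + ⋯ + a_0`. -/
def intPoly (n : ℕ) (a : Fin n → ℤ) : Polynomial ℤ :=
  Polynomial.X ^ n + ∑ i : Fin n, Polynomial.C (a i) * Polynomial.X ^ (i : ℕ)

/-- The same polynomial viewed over `ℚ`. -/
def ratPoly (n : ℕ) (a : Fin n → ℤ) : Polynomial ℚ :=
  (intPoly n a).map (Int.castRingHom ℚ)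

/-- Coefficient vectors with entries in `{-N, …, N}`: the family `𝒫_{n,N}`. -/
def coeffBox (n N : ℕ) : Finset (Fin n → ℤ) :=
  Fintype.piFinset fun _ => Finset.Icc (-(N : ℤ)) (N : ℤ)

/-- `f` is an `S_n`-polynomial: the Galois group of its splitting field `K_f` over `ℚ`
is isomorphic to the symmetric group on `n` letters. -/
def IsSnPoly (n : ℕ) (a : Fin n → ℤ) : Prop :=
  Nonempty ((ratPoly n a).Gal ≃* Equiv.Perm (Fin n))

/-- The family `𝒫⁰_{n,N}` of `S_n`-polynomials, as a finset of coefficient vectors. -/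
def P0 (n N : ℕ) : Finset (Fin n → ℤ) :=
  (coeffBox n N).filter fun a => IsSnPoly n a

/-- `ℙ_N`, the uniform probability of an event in `𝒫⁰_{n,N}`. -/
def probN (n N : ℕ) (E : (Fin n → ℤ) → Prop) : ℝ :=
  (((P0 n N).filter E).card : ℝ) / ((P0 n N).card : ℝ)

/-- `𝔼_N`, the expectation of a real random variable on `𝒫⁰_{n,N}`. -/
def expN (n N : ℕ) (F : (Fin n → ℤ) → ℝ) : ℝ :=
  (∑ a ∈ P0 n N, F a) / ((P0 n N).card : ℝ)

/-- `π(x)`, the number of rational primes `≤ x`. -/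
def primePi (x : ℝ) : ℕ :=
  ((Finset.range (⌊x⌋₊ + 1)).filter Nat.Prime).card

/-- `g ∈ 𝔽_p[X]` has splitting type `r = (r_1, …, r_n)` — encoded by `r : Fin n → ℕ` where
`r i` is `r_{i+1}`, the number of factors of degree `i+1` —, i.e. `g` is a product of
distinct monic irreducible polynomials with exactly `r i` monic irreducible factors of
degree `i+1` for each `i`. -/
def SplitTypeOf {p : ℕ} (g : Polynomial (ZMod p)) {n : ℕ} (r : Fin n → ℕ) : Prop :=
  Squarefree g ∧ ∀ i : Fin n,
    Nat.card {h : Polynomial (ZMod p) // h.Monic ∧ Irreducible h ∧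
      h.natDegree = (i : ℕ) + 1 ∧ h ∣ g} = r i

/-- `f` has splitting type `r` modulo `p`. -/
def HasSplitType (n : ℕ) (r : Fin n → ℕ) (a : Fin n → ℤ) (p : ℕ) : Prop :=
  SplitTypeOf ((intPoly n a).map (Int.castRingHom (ZMod p))) r

/-- `π_{f,r}(x)`: the number of primes `p ≤ x` such that `f` has splitting type `r` mod `p`. -/
def countSplit (n : ℕ) (r : Fin n → ℕ) (a : Fin n → ℤ) (x : ℝ) : ℕ :=
  ((Finset.range (⌊x⌋₊ + 1)).filter fun p => p.Prime ∧ HasSplitType n r a p).card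

/-- `δ(r) = ∏_{i=1}^n 1/(i^{r_i}·r_i!)`. -/
def splitDelta (n : ℕ) (r : Fin n → ℕ) : ℝ :=
  ∏ i : Fin n, (1 : ℝ) / ((((i : ℕ) + 1) ^ (r i) * Nat.factorial (r i) : ℕ) : ℝ)

/-- `r_i` as a function of the index `i ≥ 1` (so `rget n r 1 = r_1`, etc.). -/
def rget (n : ℕ) (r : Fin n → ℕ) (i : ℕ) : ℕ :=
  if h : i - 1 < n then r ⟨i - 1, h⟩ else 0

/-- `C_r = δ(r)·r_2(r_2−1)(r_1+1)(r_1+2)/(2^{r_2+1}·r_1!·r_2!)`. -/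
def splitCr (n : ℕ) (r : Fin n → ℕ) : ℝ :=
  splitDelta n r *
    ((rget n r 2 : ℝ) * ((rget n r 2 : ℝ) - 1) *
      ((rget n r 1 : ℝ) + 1) * ((rget n r 1 : ℝ) + 2)) /
    ((2 : ℝ) ^ (rget n r 2 + 1) * (Nat.factorial (rget n r 1) : ℝ) *
      (Nat.factorial (rget n r 2) : ℝ))

/-- The discriminant `D'_{ℚ_f}` of the number field `ℚ_f = ℚ(α) ≃ ℚ[X]/(f)` generated by a
root `α` of `f` (with its sign; `D_{ℚ_f}` is its absolute value), or `0` if `f` is not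
irreducible over `ℚ`. -/
def fieldDisc (n : ℕ) (a : Fin n → ℤ) : ℤ :=
  if h : Irreducible (ratPoly n a) then
    haveI : Fact (Irreducible (ratPoly n a)) := ⟨h⟩
    haveI : CharZero (AdjoinRoot (ratPoly n a)) :=
      charZero_of_injective_algebraMap (algebraMap ℚ (AdjoinRoot (ratPoly n a))).injective
    haveI : FiniteDimensional ℚ (AdjoinRoot (ratPoly n a)) :=
      PowerBasis.finite (AdjoinRoot.powerBasis h.ne_zero)
    NumberField.discr (AdjoinRoot (ratPoly n a))
  else 0

open scoped NumberField in
/-- A Frobenius element at a prime `p` modulo which `f` is separable acts on the roots of `f`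
as `x ↦ x ^ p` acts on the roots of the reduction of `f` modulo `p`. -/
theorem exists_frobenius_on_roots {L : Type} [Field L] [NumberField L] [IsGalois ℚ L]
    {f : ℤ[X]} (hf : f.Monic) (hL : (f.map (algebraMap ℤ L)).Splits) (p : ℕ) [Fact p.Prime]
    (hsep : (f.map (Int.castRingHom (ZMod p))).Separable) :
    ∃ (k : Type) (_ : Field k) (_ : Finite k) (_ : Algebra (ZMod p) k) (σ : Gal(L/ℚ))
      (r : L → k),
      Set.BijOn r (f.rootSet L) ((f.map (Int.castRingHom (ZMod p))).rootSet k) ∧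
      (∀ x ∈ f.rootSet L, r (σ x) = r x ^ p) ∧
      ((f.map (Int.castRingHom (ZMod p))).map (algebraMap (ZMod p) k)).Splits := by
  have hp : p.Prime := Fact.out
  have hintegral : ∀ x ∈ f.rootSet L, IsIntegral ℤ x := fun x hx =>
    ⟨f, hf, by simpa [aeval_def] using (mem_rootSet.1 hx).2⟩
  obtain ⟨s, hs⟩ : ∃ s : Multiset (𝓞 L), s.map (algebraMap (𝓞 L) L) =
      (f.map (algebraMap ℤ L)).roots := by
    have : CanLift L (𝓞 L) (algebraMap (𝓞 L) L) (fun x => IsIntegral ℤ x) :=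
      ⟨fun x hx => ⟨⟨x, hx⟩, rfl⟩⟩
    exact CanLift.prf (f.map (algebraMap ℤ L)).roots fun x hx =>
      hintegral x (by simpa [rootSet, aroots] using hx)
  have hfac : f.map (algebraMap ℤ (𝓞 L)) = (s.map fun a => X - C a).prod := by
    apply Polynomial.map_injective (algebraMap (𝓞 L) L) (FaithfulSMul.algebraMap_injective _ _)
    rw [Polynomial.map_map, ← IsScalarTower.algebraMap_eq,
      hL.eq_prod_roots_of_monic (hf.map _), ← hs]
    simp [Polynomial.map_multiset_prod]
  have hI : (Ideal.span {(p : ℤ)}).IsMaximal :=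
    PrincipalIdealRing.isMaximal_of_irreducible (Nat.prime_iff_prime_int.1 hp).irreducible
  obtain ⟨Q, hQm, hQ⟩ := Ideal.exists_maximal_ideal_liesOver_of_isIntegral (S := 𝓞 L)
    (Ideal.span {(p : ℤ)})
  have hpQ : (p : 𝓞 L) ∈ Q := by
    have : (p : ℤ) ∈ Q.under ℤ := by
      rw [← hQ.over]; exact Ideal.mem_span_singleton_self _
    simpa using this
  have hQ0 : Q ≠ ⊥ := by
    rintro rfl
    simp [hp.ne_zero] at hpQ
  let : Field (𝓞 L ⧸ Q) := Ideal.Quotient.field Q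
  have : Finite (𝓞 L ⧸ Q) := Ideal.finiteQuotientOfFreeOfNeBot Q hQ0
  have : CharP (𝓞 L ⧸ Q) p := (CharP.charP_iff_prime_eq_zero hp).2 (by
    rw [← map_natCast (Ideal.Quotient.mk Q)]
    exact Ideal.Quotient.eq_zero_iff_mem.2 hpQ)
  let : Algebra (ZMod p) (𝓞 L ⧸ Q) := ZMod.algebra _ p
  obtain ⟨σ, hσ⟩ := IsArithFrobAt.exists_of_isInvariant ℤ Gal(L/ℚ) Q
  have hcard : Nat.card (ℤ ⧸ Q.under ℤ) = p := by
    rw [← hQ.over]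
    simpa using Nat.card_congr (Int.quotientSpanNatEquivZMod p).toEquiv
  let r : L → 𝓞 L ⧸ Q := fun x => if h : IsIntegral ℤ x then Ideal.Quotient.mk Q ⟨x, h⟩ else 0
  have hr : ∀ x : 𝓞 L, r x = Ideal.Quotient.mk Q x := fun x => dif_pos x.isIntegral_coe
  have hmem : ∀ x ∈ f.rootSet L, ∃ a ∈ s, (a : L) = x := by
    intro x hx
    have : x ∈ (f.map (algebraMap ℤ L)).roots := by simpa [rootSet, aroots] using hx
    rw [← hs, Multiset.mem_map] at this
    exact this
  have hmem' : ∀ a ∈ s, (a : L) ∈ f.rootSet L := by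
    intro a ha
    have : (a : L) ∈ (f.map (algebraMap ℤ L)).roots := by
      rw [← hs]; exact Multiset.mem_map_of_mem _ ha
    simpa [rootSet, aroots] using this
  have hfacQ : (f.map (Int.castRingHom (ZMod p))).map (algebraMap (ZMod p) (𝓞 L ⧸ Q)) =
      ((s.map (Ideal.Quotient.mk Q)).map fun a => X - C a).prod := by
    have h1 : f.map (Int.castRingHom (𝓞 L ⧸ Q)) =
        (f.map (algebraMap ℤ (𝓞 L))).map (Ideal.Quotient.mk Q) := by
      rw [Polynomial.map_map]; congr 1
    rw [Polynomial.map_map, RingHom.ext_int ((algebraMap (ZMod p) (𝓞 L ⧸ Q)).comp _)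
      (Int.castRingHom _), h1, hfac]
    simp [Polynomial.map_multiset_prod]
  have hroots : ((f.map (Int.castRingHom (ZMod p))).map
      (algebraMap (ZMod p) (𝓞 L ⧸ Q))).roots = s.map (Ideal.Quotient.mk Q) := by
    rw [hfacQ, roots_multiset_prod_X_sub_C]
  have hnodup : (s.map (Ideal.Quotient.mk Q)).Nodup := by
    rw [← hroots]
    exact nodup_roots hsep.map
  refine ⟨𝓞 L ⧸ Q, inferInstance, inferInstance, inferInstance, σ, r, ⟨?_, ?_, ?_⟩, ?_, ?_⟩
  · intro x hx
    obtain ⟨a, ha, rfl⟩ := hmem x hx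
    have : r a ∈ ((f.map (Int.castRingHom (ZMod p))).map
        (algebraMap (ZMod p) (𝓞 L ⧸ Q))).roots := by
      rw [hroots, hr]; exact Multiset.mem_map_of_mem _ ha
    simpa [rootSet, aroots] using this
  · intro x hx y hy hxy
    obtain ⟨a, ha, rfl⟩ := hmem x hx
    obtain ⟨b, hb, rfl⟩ := hmem y hy
    rw [hr, hr] at hxy
    rw [Multiset.inj_on_of_nodup_map hnodup a ha b hb hxy]
  · intro y hy
    have : y ∈ ((f.map (Int.castRingHom (ZMod p))).map
        (algebraMap (ZMod p) (𝓞 L ⧸ Q))).roots := by simpa [rootSet, aroots] using hy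
    rw [hroots, Multiset.mem_map] at this
    obtain ⟨a, ha, rfl⟩ := this
    exact ⟨a, hmem' a ha, hr a⟩
  · intro x hx
    obtain ⟨a, ha, rfl⟩ := hmem x hx
    have h2 := hσ.mk_apply a
    rw [hcard] at h2
    rw [hr, ← map_pow, show σ (a : L) = ((σ • a : 𝓞 L) : L) from rfl, hr, map_pow]
    exact h2
  · rw [hfacQ]
    exact Splits.multisetProd (by simp)

/-- A transitive group of permutations that contains a transposition and an element fixing a point
and permuting the other points transitively is the full symmetric group. -/
theorem Subgroup.eq_top_of_isSwap_of_transitive {Ω : Type*} [Finite Ω] [DecidableEq Ω]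
    {G : Subgroup (Equiv.Perm Ω)} (htrans : ∀ x y, ∃ g ∈ G, g x = y)
    {τ : Equiv.Perm Ω} (hτ : τ ∈ G) (hswap : τ.IsSwap)
    {σ : Equiv.Perm Ω} (hσ : σ ∈ G) {o : Ω} (hfix : σ o = o)
    (hcyc : ∀ x ≠ o, ∀ y ≠ o, ∃ i : ℕ, (σ ^ i) x = y) : G = ⊤ := by
  have hconj : ∀ g ∈ G, ∀ x y, Equiv.swap x y ∈ G → Equiv.swap (g x) (g y) ∈ G := by
    intro g hg x y h
    rw [Equiv.swap_apply_apply]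
    exact G.mul_mem (G.mul_mem hg h) (G.inv_mem hg)
  obtain ⟨x, y, hxy, rfl⟩ := hswap
  obtain ⟨g, hg, hgx⟩ := htrans x o
  have hgy : g y ≠ o := fun h => hxy (g.injective (hgx.trans h.symm))
  have hfixpow : ∀ i : ℕ, (σ ^ i) o = o := fun i => by
    induction i with
    | zero => rfl
    | succ i ih => rw [pow_succ, Equiv.Perm.mul_apply, hfix, ih]
  have hstar : ∀ d, Equiv.swap o d ∈ G := by
    intro d
    by_cases hd : d = o
    · rw [hd, Equiv.swap_self]
      exact G.one_mem
    obtain ⟨i, hi⟩ := hcyc (g y) hgy d hd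
    have := hconj _ (G.pow_mem hσ i) _ _ (hconj g hg x y hτ)
    rwa [hgx, hfixpow, hi] at this
  rw [eq_top_iff, ← Equiv.Perm.closure_isSwap, Subgroup.closure_le]
  rintro _ ⟨a, b, hab, rfl⟩
  by_cases ha : a = o
  · rw [ha]; exact hstar b
  by_cases hb : b = o
  · rw [hb, Equiv.swap_comm]; exact hstar a
  · have := hconj _ (hstar a) o b (hstar b)
    rwa [Equiv.swap_apply_left, Equiv.swap_apply_of_ne_of_ne hb (Ne.symm hab)] at this

theorem galois_mem_rootSet {L : Type*} [Field L] [CharZero L] {f : ℤ[X]} (σ : Gal(L/ℚ))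
    {x : L} (hx : x ∈ f.rootSet L) :
    σ x ∈ f.rootSet L := by
  rw [mem_rootSet] at hx ⊢
  refine ⟨hx.1, ?_⟩
  have := congrArg σ hx.2
  rwa [map_zero, ← AlgEquiv.coe_toAlgHom, ← AlgHom.coe_restrictScalars' ℤ, ← aeval_algHom_apply]
    at this

section GaloisAction

variable {L : Type} [Field L] [NumberField L] [IsGalois ℚ L] {f : ℤ[X]}

/-- If the reduction of `f` modulo `p` is separable, has all but two of its roots in `𝔽_p` and has
an irreducible factor of degree at least two, then some Galois automorphism moves at most two
roots of `f`, but not none. -/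
theorem exists_galois_almost_fixing_roots (hf : f.Monic)
    (hL : (f.map (algebraMap ℤ L)).Splits) (p : ℕ) [Fact p.Prime]
    (hsep : (f.map (Int.castRingHom (ZMod p))).Separable)
    {S : Finset (ZMod p)} (hS : ∀ c ∈ S, (f.map (Int.castRingHom (ZMod p))).eval c = 0)
    {q : (ZMod p)[X]} (hq : Irreducible q) (hqd : 2 ≤ q.natDegree)
    (hqf : q ∣ f.map (Int.castRingHom (ZMod p))) :
    ∃ σ : Gal(L/ℚ), (∃ x ∈ f.rootSet L, σ x ≠ x) ∧
      ∃ T : Finset L, T.card = S.card ∧ ∀ x ∈ T, x ∈ f.rootSet L ∧ σ x = x := by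
  obtain ⟨k, _, _, _, σ, r, hr, hσ, hsplit⟩ := exists_frobenius_on_roots hf hL p hsep
  have h0 : f.map (Int.castRingHom (ZMod p)) ≠ 0 := (hf.map _).ne_zero
  have hσmem : ∀ x ∈ f.rootSet L, σ x ∈ f.rootSet L := fun x hx => galois_mem_rootSet σ hx
  refine ⟨σ, ?_, ?_⟩
  · by_contra! hfix
    have hqs : (q.map (algebraMap (ZMod p) k)).Splits :=
      hsplit.of_dvd (Polynomial.map_ne_zero h0) (Polynomial.map_dvd _ hqf)
    obtain ⟨y, hy⟩ := hqs.exists_eval_eq_zero (by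
      rw [degree_map]; exact (natDegree_pos_iff_degree_pos.1 (by omega)).ne')
    rw [eval_map_algebraMap] at hy
    obtain ⟨x, hx, rfl⟩ := hr.surjOn (a := y) (by
      rw [mem_rootSet]
      obtain ⟨g, hg⟩ := hqf
      exact ⟨h0, by rw [hg, map_mul, hy, zero_mul]⟩)
    have hxp : r x ^ p = r x := by rw [← hσ x hx, hfix x hx]
    obtain ⟨c, hc⟩ : ∃ c : ZMod p, algebraMap (ZMod p) k c = r x := by
      rw [← Set.mem_range, ← IntermediateField.mem_bot, IsGalois.mem_bot_iff_fixed]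
      intro τ
      obtain ⟨i, rfl⟩ := (FiniteField.bijective_frobeniusAlgEquivOfAlgebraic_pow (ZMod p) k).2 τ
      have : ∀ i : ℕ, (FiniteField.frobeniusAlgEquivOfAlgebraic (ZMod p) k ^ i) (r x) = r x := by
        intro i
        induction i with
        | zero => simp
        | succ i ih =>
          rw [pow_succ', AlgEquiv.mul_apply, ih, FiniteField.coe_frobeniusAlgEquivOfAlgebraic]
          simpa [ZMod.card] using hxp
      exact this i
    rw [← hc, aeval_algebraMap_apply_eq_algebraMap_eval, map_eq_zero] at hy
    have : q.natDegree = 1 :=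
      natDegree_eq_of_degree_eq_some (degree_eq_one_of_irreducible_of_root hq hy)
    omega
  · have hex : ∀ c ∈ S, ∃ x ∈ f.rootSet L, r x = algebraMap (ZMod p) k c := by
      intro c hc
      obtain ⟨x, hx, h⟩ := hr.surjOn (a := algebraMap (ZMod p) k c) (by
        rw [mem_rootSet]
        exact ⟨h0, by rw [aeval_algebraMap_apply_eq_algebraMap_eval, hS c hc, map_zero]⟩)
      exact ⟨x, hx, h⟩
    choose! t ht htr using hex
    refine ⟨S.image t, card_image_of_injOn ?_, ?_⟩
    · intro c hc d hd hcd
      apply (algebraMap (ZMod p) k).injective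
      rw [← htr c hc, ← htr d hd, hcd]
    · intro x hx
      obtain ⟨c, hc, rfl⟩ := mem_image.1 hx
      refine ⟨ht c hc, hr.injOn (hσmem _ (ht c hc)) (ht c hc) ?_⟩
      rw [hσ _ (ht c hc), htr c hc, ← map_pow, ZMod.pow_card]

/-- If the reduction of `f` modulo `p` is separable and is the product of a linear and an
irreducible polynomial, then some Galois automorphism fixes a root of `f` and permutes the other
roots transitively. -/
theorem exists_galois_fixing_root_of_transitive (hf : f.Monic)
    (hL : (f.map (algebraMap ℤ L)).Splits) (p : ℕ) [Fact p.Prime]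
    (hsep : (f.map (Int.castRingHom (ZMod p))).Separable) {c : ZMod p} {q : (ZMod p)[X]}
    (hq : Irreducible q) (hqf : f.map (Int.castRingHom (ZMod p)) = (X - C c) * q) :
    ∃ σ : Gal(L/ℚ), ∃ o ∈ f.rootSet L, σ o = o ∧
      ∀ x ∈ f.rootSet L, x ≠ o → ∀ y ∈ f.rootSet L, y ≠ o → ∃ i : ℕ, (σ ^ i) x = y := by
  obtain ⟨k, _, _, _, σ, r, hr, hσ, hsplit⟩ := exists_frobenius_on_roots hf hL p hsep
  have h0 : f.map (Int.castRingHom (ZMod p)) ≠ 0 := (hf.map _).ne_zero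
  have hσmem : ∀ x ∈ f.rootSet L, σ x ∈ f.rootSet L := fun x hx => galois_mem_rootSet σ hx
  obtain ⟨o, ho, hoc⟩ := hr.surjOn (a := algebraMap (ZMod p) k c) (by
    rw [mem_rootSet]
    exact ⟨h0, by rw [aeval_algebraMap_apply_eq_algebraMap_eval, hqf]; simp⟩)
  have hrootq : ∀ x ∈ f.rootSet L, x ≠ o → aeval (r x) q = 0 := by
    intro x hx hxo
    have h1 := (mem_rootSet.1 (hr.mapsTo hx)).2
    rw [hqf, map_mul, mul_eq_zero] at h1
    refine h1.resolve_left fun h => hxo (hr.injOn hx ho ?_)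
    rw [hoc]
    simpa [sub_eq_zero] using h
  refine ⟨σ, o, ho, hr.injOn (hσmem o ho) ho ?_, ?_⟩
  · rw [hσ o ho, hoc, ← map_pow, ZMod.pow_card]
  intro x hx hxo y hy hyo
  have hconj : IsConjRoot (ZMod p) (r x) (r y) := by
    rw [isConjRoot_def, ← minpoly.eq_of_irreducible hq (hrootq x hx hxo),
      ← minpoly.eq_of_irreducible hq (hrootq y hy hyo)]
  obtain ⟨τ, hτ⟩ := isConjRoot_iff_exists_algEquiv.1 hconj.symm
  obtain ⟨i, hi⟩ := (FiniteField.bijective_frobeniusAlgEquivOfAlgebraic_pow (ZMod p) k).2 τ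
  have hpow : ∀ i : ℕ, (σ ^ i) x ∈ f.rootSet L ∧ r ((σ ^ i) x) = r x ^ p ^ i := by
    intro i
    induction i with
    | zero => simpa using hx
    | succ i ih =>
      rw [pow_succ', AlgEquiv.mul_apply]
      exact ⟨hσmem _ ih.1, by rw [hσ _ ih.1, ih.2, ← pow_mul, ← pow_succ]⟩
  refine ⟨i, hr.injOn (hpow i).1 hy ?_⟩
  rw [(hpow i).2, ← hτ, ← hi]
  have : ∀ i : ℕ, (FiniteField.frobeniusAlgEquivOfAlgebraic (ZMod p) k ^ i) (r x) =
      r x ^ p ^ i := by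
    intro i
    induction i with
    | zero => simp
    | succ i ih =>
      rw [pow_succ', AlgEquiv.mul_apply, ih, FiniteField.coe_frobeniusAlgEquivOfAlgebraic]
      simp [ZMod.card, ← pow_mul, ← pow_succ]
  exact (this i).symm

end GaloisAction

theorem degree_sum_C_mul_X_pow_lt (n : ℕ) (a : Fin n → ℤ) :
    (∑ i : Fin n, C (a i) * X ^ (i : ℕ) : ℤ[X]).degree < n :=
  (degree_sum_le _ _).trans_lt ((Finset.sup_lt_iff (by simp)).2 fun i _ =>
    (degree_C_mul_X_pow_le _ _).trans_lt (by exact_mod_cast i.2))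

theorem monic_intPoly (n : ℕ) (a : Fin n → ℤ) : (intPoly n a).Monic :=
  monic_X_pow_add (degree_sum_C_mul_X_pow_lt n a)

theorem natDegree_intPoly (n : ℕ) (a : Fin n → ℤ) : (intPoly n a).natDegree = n :=
  natDegree_eq_of_degree_eq_some (by
    rw [intPoly, degree_add_eq_left_of_degree_lt] <;> rw [degree_X_pow]
    exact degree_sum_C_mul_X_pow_lt n a)

theorem coeff_intPoly (n : ℕ) (a : Fin n → ℤ) (i : Fin n) : (intPoly n a).coeff i = a i := by
  simp only [intPoly, coeff_add, coeff_X_pow, finsetSum_coeff, coeff_C_mul]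
  rw [if_neg i.2.ne, zero_add, Finset.sum_eq_single i]
  · simp
  · intro j _ hj
    simp [Fin.val_eq_val, Ne.symm hj]
  · simp

theorem intPoly_coeff {n : ℕ} {f : ℤ[X]} (hf : f.Monic) (hn : f.natDegree = n) :
    intPoly n (fun i => f.coeff i) = f := by
  conv_rhs => rw [hf.as_sum, hn]
  rw [intPoly, Fin.sum_univ_eq_sum_range (fun i => C (f.coeff i) * X ^ i)]

theorem intPoly_injective (n : ℕ) : Function.Injective (intPoly n) := fun a b h =>
  funext fun i => by rw [← coeff_intPoly n a, h, coeff_intPoly]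

theorem monic_ratPoly (n : ℕ) (a : Fin n → ℤ) : (ratPoly n a).Monic := (monic_intPoly n a).map _

theorem natDegree_ratPoly (n : ℕ) (a : Fin n → ℤ) : (ratPoly n a).natDegree = n := by
  rw [ratPoly, (monic_intPoly n a).natDegree_map, natDegree_intPoly]

/-- Reductions of `f` modulo three primes that force the Galois group of `f` to be `S_n`. -/
theorem nonempty_gal_mulEquiv_perm_of_reductions {L : Type} [Field L] [NumberField L] {f : ℤ[X]}
    (hf : f.Monic) [IsSplittingField ℚ L (f.map (Int.castRingHom ℚ))] {p₁ p₂ p₃ : ℕ}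
    [Fact p₁.Prime] [Fact p₂.Prime] [Fact p₃.Prime]
    (h₁ : Irreducible (f.map (Int.castRingHom (ZMod p₁))))
    (hsep₂ : (f.map (Int.castRingHom (ZMod p₂))).Separable)
    {c : ZMod p₂} {q₂ : (ZMod p₂)[X]} (hq₂ : Irreducible q₂)
    (h₂ : f.map (Int.castRingHom (ZMod p₂)) = (X - C c) * q₂)
    (hsep₃ : (f.map (Int.castRingHom (ZMod p₃))).Separable)
    {S : Finset (ZMod p₃)} (hScard : f.natDegree ≤ S.card + 2)
    (hS : ∀ c ∈ S, (f.map (Int.castRingHom (ZMod p₃))).eval c = 0)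
    {q₃ : (ZMod p₃)[X]} (hq₃ : Irreducible q₃) (hqd₃ : 2 ≤ q₃.natDegree)
    (hqf₃ : q₃ ∣ f.map (Int.castRingHom (ZMod p₃))) :
    Nonempty (Gal(L/ℚ) ≃* Equiv.Perm (Fin f.natDegree)) := by
  obtain ⟨F, hF⟩ : ∃ F, F = f.map (Int.castRingHom ℚ) := ⟨_, rfl⟩
  have hirr : Irreducible F := by
    rw [hF]
    exact (hf.irreducible_iff_irreducible_map_fraction_map (K := ℚ)).1
      (hf.irreducible_of_irreducible_map _ _ h₁)
  have hmonic : F.Monic := hF ▸ hf.map _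
  have hsplit : IsSplittingField ℚ L F := hF ▸ inferInstance
  have hsep := hirr.separable
  have : IsGalois ℚ L := IsGalois.of_separable_splitting_field hsep
  have hmap : F.map (algebraMap ℚ L) = f.map (algebraMap ℤ L) := by
    rw [hF, Polynomial.map_map]
    congr 1
    exact RingHom.ext_int _ _
  have hL : (f.map (algebraMap ℤ L)).Splits := hmap ▸ IsSplittingField.splits L F
  have hroots : f.rootSet L = F.rootSet L := by
    simp only [rootSet, aroots, hmap]
  have hcard : Nat.card (F.rootSet L) = f.natDegree := by
    rw [Nat.card_eq_fintype_card, card_rootSet_eq_natDegree hsep (IsSplittingField.splits L F),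
      hF, hf.natDegree_map]
  have : Finite (F.rootSet L) := (F.rootSet_finite L)
  have hmem : ∀ (σ : Gal(L/ℚ)) {x : L}, x ∈ F.rootSet L → σ x ∈ F.rootSet L := by
    rw [← hroots]
    exact fun σ _ hx => galois_mem_rootSet σ hx
  let φ : Gal(L/ℚ) →* Equiv.Perm (F.rootSet L) :=
    { toFun := fun σ =>
        { toFun := fun x => ⟨σ x, hmem σ x.2⟩
          invFun := fun x => ⟨σ⁻¹ x, hmem σ⁻¹ x.2⟩
          left_inv := fun x => Subtype.ext (σ.symm_apply_apply x)
          right_inv := fun x => Subtype.ext (σ.apply_symm_apply x) }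
      map_one' := rfl
      map_mul' := fun _ _ => rfl }
  have hφ : ∀ (σ : Gal(L/ℚ)) (x : F.rootSet L), ((φ σ x : F.rootSet L) : L) = σ x :=
    fun _ _ => rfl
  have hinj : Function.Injective φ := fun σ τ h => by
    refine AlgEquiv.coe_toAlgHom_injective (AlgHom.ext_of_adjoin_eq_top
      (IsSplittingField.adjoin_rootSet L F) fun x hx => ?_)
    exact (hφ σ ⟨x, hx⟩).symm.trans (by rw [h, hφ]; rfl)
  have htop : φ.range = ⊤ := by
    obtain ⟨σ, ⟨x, hx, hσx⟩, T, hTcard, hT⟩ :=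
      exists_galois_almost_fixing_roots hf hL p₃ hsep₃ hS hq₃ hqd₃ hqf₃
    obtain ⟨τ, o, ho, hτo, hτ⟩ := exists_galois_fixing_root_of_transitive hf hL p₂ hsep₂ hq₂ h₂
    rw [hroots] at hx ho hτ hT
    have hφpow : ∀ i : ℕ, (φ τ) ^ i = φ (τ ^ i) := fun i => (map_pow φ _ _).symm
    refine Subgroup.eq_top_of_isSwap_of_transitive (τ := φ σ) (σ := φ τ) (o := ⟨o, ho⟩)
      ?_ ⟨σ, rfl⟩ ?_ ⟨τ, rfl⟩ (Subtype.ext hτo) ?_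
    · intro x y
      have hconj : IsConjRoot ℚ (x : L) (y : L) := by
        have h1 := minpoly.eq_of_irreducible_of_monic hirr (mem_rootSet.1 x.2).2 hmonic
        have h2 := minpoly.eq_of_irreducible_of_monic hirr (mem_rootSet.1 y.2).2 hmonic
        exact h1.symm.trans h2
      obtain ⟨g, hg⟩ := isConjRoot_iff_exists_algEquiv.1 hconj.symm
      exact ⟨φ g, ⟨g, rfl⟩, Subtype.ext hg⟩
    · have := Fintype.ofFinite (F.rootSet L)
      rw [← Equiv.Perm.card_support_eq_two]
      refine le_antisymm ?_ (Equiv.Perm.two_le_card_support_of_ne_one fun h => hσx ?_)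
      · let ι : T → F.rootSet L := fun t => ⟨t, (hT t t.2).1⟩
        have hι : Function.Injective ι := fun s t h =>
          Subtype.ext (congrArg (fun z : F.rootSet L => (z : L)) h)
        have h1 : T.attach.image ι ⊆ (φ σ).supportᶜ := by
          intro y hy
          obtain ⟨t, -, rfl⟩ := Finset.mem_image.1 hy
          simpa using Subtype.ext (hT t t.2).2
        have h2 := Finset.card_le_card h1
        rw [Finset.card_image_of_injective _ hι, Finset.card_attach, hTcard,
          Finset.card_compl, ← Nat.card_eq_fintype_card, hcard] at h2
        have h3 := Finset.card_le_univ (φ σ).support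
        rw [← Nat.card_eq_fintype_card, hcard] at h3
        omega
      · exact (hφ σ ⟨x, hx⟩).symm.trans (by rw [h]; rfl)
    · intro x hxo y hyo
      obtain ⟨i, hi⟩ := hτ x x.2 (fun h => hxo (Subtype.ext h)) y y.2
        (fun h => hyo (Subtype.ext h))
      exact ⟨i, by rw [hφpow]; exact Subtype.ext hi⟩
  exact ⟨(MulEquiv.ofBijective φ ⟨hinj, MonoidHom.range_eq_top.1 htop⟩).trans
    (Equiv.permCongrHom (Finite.equivFinOfCardEq hcard))⟩

theorem isSnPoly_of_reductions {n : ℕ} {a : Fin n → ℤ} {p₁ p₂ p₃ : ℕ}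
    [Fact p₁.Prime] [Fact p₂.Prime] [Fact p₃.Prime]
    (h₁ : Irreducible ((intPoly n a).map (Int.castRingHom (ZMod p₁))))
    (hsep₂ : ((intPoly n a).map (Int.castRingHom (ZMod p₂))).Separable)
    {c : ZMod p₂} {q₂ : (ZMod p₂)[X]} (hq₂ : Irreducible q₂)
    (h₂ : (intPoly n a).map (Int.castRingHom (ZMod p₂)) = (X - C c) * q₂)
    (hsep₃ : ((intPoly n a).map (Int.castRingHom (ZMod p₃))).Separable)
    {S : Finset (ZMod p₃)} (hScard : n ≤ S.card + 2)
    (hS : ∀ c ∈ S, ((intPoly n a).map (Int.castRingHom (ZMod p₃))).eval c = 0)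
    {q₃ : (ZMod p₃)[X]} (hq₃ : Irreducible q₃) (hqd₃ : 2 ≤ q₃.natDegree)
    (hqf₃ : q₃ ∣ (intPoly n a).map (Int.castRingHom (ZMod p₃))) : IsSnPoly n a := by
  have : NumberField (ratPoly n a).SplittingField := {}
  have : IsSplittingField ℚ (ratPoly n a).SplittingField ((intPoly n a).map (Int.castRingHom ℚ)) :=
    IsSplittingField.splittingField (ratPoly n a)
  have h := nonempty_gal_mulEquiv_perm_of_reductions (L := (ratPoly n a).SplittingField)
    (monic_intPoly n a) h₁ hsep₂ hq₂ h₂ hsep₃ (by rwa [natDegree_intPoly]) hS hq₃ hqd₃ hqf₃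
  rwa [natDegree_intPoly] at h

theorem exists_monic_irreducible_eval_zero_ne_zero (p : ℕ) [Fact p.Prime] {m : ℕ} (hm : m ≠ 0) :
    ∃ q : (ZMod p)[X], q.Monic ∧ Irreducible q ∧ q.natDegree = m ∧ q.eval 0 ≠ 0 := by
  by_cases h1 : m = 1
  · exact ⟨X - C 1, monic_X_sub_C 1, irreducible_X_sub_C 1, by rw [h1, natDegree_X_sub_C],
      by simp⟩
  obtain ⟨α, hα⟩ := Field.exists_primitive_element (ZMod p) (GaloisField p m)
  have hintegral : IsIntegral (ZMod p) α := .of_finite _ _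
  have hdeg : (minpoly (ZMod p) α).natDegree = m := by
    rw [(Field.primitive_element_iff_minpoly_natDegree_eq (ZMod p) α).1 hα,
      GaloisField.finrank p hm]
  refine ⟨_, minpoly.monic hintegral, minpoly.irreducible hintegral, hdeg, fun h => h1 ?_⟩
  rw [← hdeg]
  exact natDegree_eq_of_degree_eq_some
    (degree_eq_one_of_irreducible_of_root (minpoly.irreducible hintegral) h)

theorem isCoprime_X_sub_C_of_eval_ne_zero {k : Type*} [Field k] {q : k[X]} {c : k}
    (h : q.eval c ≠ 0) : IsCoprime (X - C c) q :=
  (irreducible_X_sub_C c).coprime_iff_not_dvd.2 fun hd => h (dvd_iff_isRoot.1 hd)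

theorem exists_int_cast_eq {p₁ p₂ p₃ : ℕ} [NeZero p₁] [NeZero p₂] [NeZero p₃]
    (h₁₂ : p₁.Coprime p₂) (h₃ : (p₁ * p₂).Coprime p₃) (x : ZMod p₁) (y : ZMod p₂) (z : ZMod p₃) :
    ∃ k : ℤ, (k : ZMod p₁) = x ∧ (k : ZMod p₂) = y ∧ (k : ZMod p₃) = z := by
  obtain ⟨u, hu₁, hu₂⟩ := Nat.chineseRemainder h₁₂ x.val y.val
  obtain ⟨v, hv, hv₃⟩ := Nat.chineseRemainder h₃ u z.val
  have hv₁ := (hv.of_dvd (dvd_mul_right _ _)).trans hu₁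
  have hv₂ := (hv.of_dvd (dvd_mul_left _ _)).trans hu₂
  rw [← ZMod.natCast_eq_natCast_iff, ZMod.natCast_zmod_val] at hv₁ hv₂ hv₃
  exact ⟨v, by simpa using hv₁, by simpa using hv₂, by simpa using hv₃⟩

theorem map_intPoly_eq_of_coeff {n : ℕ} {R : Type*} [CommRing R] [Nontrivial R] {g : R[X]}
    (hg : g.Monic) (hn : g.natDegree = n) {a : Fin n → ℤ} (ha : ∀ i, (a i : R) = g.coeff i) :
    (intPoly n a).map (Int.castRingHom R) = g := by
  conv_rhs => rw [hg.as_sum, hn]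
  rw [intPoly, ← Fin.sum_univ_eq_sum_range (fun i => C (g.coeff i) * X ^ i)]
  simp [Polynomial.map_sum, ← ha]

/-- There is a residue class of coefficient vectors that consists of `S_n`-polynomials. -/
theorem exists_residue_class_isSnPoly {n : ℕ} (hn : 2 ≤ n) :
    ∃ M : ℕ, 0 < M ∧ ∃ r : Fin n → ℤ, ∀ b : Fin n → ℤ, IsSnPoly n fun i => r i + M * b i := by
  obtain ⟨p, hpn, hp⟩ := Nat.exists_infinite_primes (n + 5)
  have : Fact p.Prime := ⟨hp⟩
  obtain ⟨g₁, hm₁, hi₁, hd₁, -⟩ :=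
    exists_monic_irreducible_eval_zero_ne_zero 2 (m := n) (by omega)
  obtain ⟨q₂, hm₂, hi₂, hd₂, hz₂⟩ :=
    exists_monic_irreducible_eval_zero_ne_zero 3 (m := n - 1) (by omega)
  obtain ⟨q₃, hm₃, hi₃, hd₃, -⟩ :=
    exists_monic_irreducible_eval_zero_ne_zero p (m := 2) (by omega)
  obtain ⟨S, -, hS⟩ := Finset.exists_subset_card_eq (s := (Finset.univ : Finset (ZMod p)))
    (n := n - 2) (by rw [Finset.card_univ, Fintype.card_eq_nat_card, Nat.card_zmod]; omega)
  have hroot₃ : ∀ c, q₃.eval c ≠ 0 := fun c h => by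
    have : q₃.natDegree = 1 :=
      natDegree_eq_of_degree_eq_some (degree_eq_one_of_irreducible_of_root hi₃ h)
    omega
  have hmS : (∏ c ∈ S, (X - C c)).Monic := monic_prod_of_monic _ _ fun c _ => monic_X_sub_C c
  have hg₂ : ((X - C 0) * q₂).Monic := (monic_X_sub_C 0).mul hm₂
  have hg₃ : ((∏ c ∈ S, (X - C c)) * q₃).Monic := hmS.mul hm₃
  have hdeg₂ : ((X - C 0) * q₂).natDegree = n := by
    rw [(monic_X_sub_C 0).natDegree_mul hm₂, natDegree_X_sub_C, hd₂]; omega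
  have hdeg₃ : ((∏ c ∈ S, (X - C c)) * q₃).natDegree = n := by
    rw [hmS.natDegree_mul hm₃, natDegree_finsetProd_X_sub_C_eq_card, hS, hd₃]; omega
  have hcop : (2 * 3 : ℕ).Coprime p := by
    rw [Nat.coprime_mul_iff_left, Nat.coprime_primes Nat.prime_two hp,
      Nat.coprime_primes Nat.prime_three hp]
    omega
  choose r hr₁ hr₂ hr₃ using fun i : Fin n => exists_int_cast_eq (p₁ := 2) (p₂ := 3) (by norm_num)
    hcop (g₁.coeff i) (((X - C 0) * q₂).coeff i) (((∏ c ∈ S, (X - C c)) * q₃).coeff i)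
  refine ⟨2 * 3 * p, mul_pos (by norm_num) hp.pos, r, fun b => ?_⟩
  have e₁ := map_intPoly_eq_of_coeff hm₁ hd₁ (a := fun i => r i + (2 * 3 * p : ℕ) * b i)
    fun i => by simp [hr₁, show (6 : ZMod 2) = 0 from rfl]
  have e₂ := map_intPoly_eq_of_coeff hg₂ hdeg₂ (a := fun i => r i + (2 * 3 * p : ℕ) * b i)
    fun i => by rw [← hr₂]; simp [show (6 : ZMod 3) = 0 from rfl]
  have e₃ := map_intPoly_eq_of_coeff hg₃ hdeg₃ (a := fun i => r i + (2 * 3 * p : ℕ) * b i)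
    fun i => by rw [← hr₃]; simp
  refine isSnPoly_of_reductions (p₁ := 2) (p₂ := 3) (p₃ := p) (by rwa [e₁]) ?_ hi₂ e₂ ?_
    (S := S) (by omega) (fun c hc => ?_) hi₃ hd₃.ge (e₃ ▸ dvd_mul_left _ _)
  · rw [e₂]
    exact separable_X_sub_C.mul (PerfectField.separable_of_irreducible hi₂)
      (isCoprime_X_sub_C_of_eval_ne_zero hz₂)
  · rw [e₃]
    refine Separable.mul ?_ (PerfectField.separable_of_irreducible hi₃)
      (IsCoprime.prod_left fun c _ => isCoprime_X_sub_C_of_eval_ne_zero (hroot₃ c))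
    exact separable_prod_X_sub_C_iff'.2 fun _ _ _ _ h => h
  · rw [e₃, eval_mul, eval_prod, Finset.prod_eq_zero hc (by simp), zero_mul]

/-- The family `𝒫⁰_{n,N}` has at least a positive proportion of the elements of `𝒫_{n,N}`. -/
theorem exists_mul_pow_le_card_P0 {n : ℕ} (hn : 2 ≤ n) :
    ∃ c : ℝ, 0 < c ∧ ∀ᶠ N : ℕ in atTop, c * (N : ℝ) ^ n ≤ (P0 n N).card := by
  obtain ⟨M, hM, r, hr⟩ := exists_residue_class_isSnPoly hn
  obtain ⟨R, hR⟩ : ∃ R : ℕ, ∀ i, |r i| ≤ R := by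
    refine ⟨∑ i, (r i).natAbs, fun i => ?_⟩
    rw [Int.abs_eq_natAbs]
    exact_mod_cast Finset.single_le_sum (f := fun i => (r i).natAbs) (fun _ _ => Nat.zero_le _)
      (Finset.mem_univ i)
  refine ⟨(1 / (2 * M : ℝ)) ^ n, by positivity, ?_⟩
  filter_upwards [eventually_ge_atTop (2 * R)] with N hN
  let B : Finset (Fin n → ℤ) := Fintype.piFinset fun _ => Finset.Icc (0 : ℤ) ((N - R) / M : ℕ)
  have hB : B.card ≤ (P0 n N).card := by
    refine Finset.card_le_card_of_injOn (fun b i => r i + M * b i) (fun b hb => ?_) ?_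
    · rw [Finset.mem_coe, P0, Finset.mem_filter]
      refine ⟨?_, hr b⟩
      rw [coeffBox, Fintype.mem_piFinset]
      intro i
      have hbi := Finset.mem_Icc.1 (Fintype.mem_piFinset.1 hb i)
      have hMb : (M : ℤ) * b i ≤ N - R := by
        have h1 : (M : ℤ) * b i ≤ M * ((N - R) / M : ℕ) :=
          mul_le_mul_of_nonneg_left hbi.2 (by positivity)
        have h2 : M * ((N - R) / M) ≤ N - R := Nat.mul_div_le _ _
        have h3 : ((M * ((N - R) / M) : ℕ) : ℤ) ≤ ((N - R : ℕ) : ℤ) := by exact_mod_cast h2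
        rw [Nat.cast_sub (by omega)] at h3
        push_cast at h1 h3 ⊢
        linarith
      have h0 : 0 ≤ (M : ℤ) * b i := mul_nonneg (by positivity) hbi.1
      have := abs_le.1 (hR i)
      rw [Finset.mem_Icc]
      constructor <;> dsimp only <;> omega
    · intro b _ b' _ h
      funext i
      have := congrFun h i
      simpa [hM.ne'] using this
  have hcard : B.card = ((N - R) / M + 1) ^ n := by
    rw [Fintype.card_piFinset_const, Int.card_Icc]
    congr 1
  refine le_trans ?_ (Nat.cast_le.2 hB)
  rw [hcard, ← mul_pow, Nat.cast_pow]
  refine pow_le_pow_left₀ (by positivity) ?_ n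
  have h1 : N - R < M * ((N - R) / M + 1) := Nat.lt_mul_div_succ _ hM
  have h2 : N ≤ 2 * (M * ((N - R) / M + 1)) := by omega
  have h3 : (N : ℝ) ≤ 2 * (M * ((N - R) / M + 1 : ℕ)) := by exact_mod_cast h2
  have hM' : (0 : ℝ) < M := by exact_mod_cast hM
  rw [one_div, inv_mul_le_iff₀ (by positivity)]
  linarith

theorem natCard_gal_le_factorial (p : ℚ[X]) : Nat.card p.Gal ≤ p.natDegree.factorial := by
  have : Fact ((p.map (algebraMap ℚ p.SplittingField)).Splits) := ⟨SplittingField.splits p⟩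
  have : Finite (p.rootSet p.SplittingField) := p.rootSet_finite _
  refine (Nat.card_le_card_of_injective _ (Gal.galActionHom_injective p p.SplittingField)).trans ?_
  rw [Nat.card_perm]
  refine Nat.factorial_le ?_
  rw [Nat.card_coe_set_eq]
  exact ncard_rootSet_le p _

/-- A polynomial whose Galois group is the full symmetric group is irreducible. -/
theorem IsSnPoly.irreducible {n : ℕ} (hn : 2 ≤ n) {a : Fin n → ℤ} (h : IsSnPoly n a) :
    Irreducible (ratPoly n a) := by
  have hcard : Nat.card (ratPoly n a).Gal = n.factorial := by
    obtain ⟨e⟩ := h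
    rw [Nat.card_congr e.toEquiv, Nat.card_perm, Nat.card_fin]
  have hdeg := natDegree_ratPoly n a
  rw [(monic_ratPoly n a).irreducible_iff_natDegree']
  refine ⟨fun h1 => ?_, fun f g hf hg hfg hmem => ?_⟩
  · rw [h1, natDegree_one] at hdeg
    omega
  rw [hdeg, Finset.mem_Ioc] at hmem
  have hsum : f.natDegree + g.natDegree = n := by rw [← hf.natDegree_mul hg, hfg, hdeg]
  have hle : n.factorial ≤ f.natDegree.factorial * g.natDegree.factorial := by
    rw [← hcard, ← hfg]
    refine (Nat.card_le_card_of_injective _ (Gal.restrictProd_injective f g)).trans ?_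
    rw [Nat.card_prod]
    exact Nat.mul_le_mul (natCard_gal_le_factorial f) (natCard_gal_le_factorial g)
  have hpow : g.natDegree.factorial < (f.natDegree + 1) ^ g.natDegree :=
    (Nat.factorial_le_pow _).trans_lt (Nat.pow_lt_pow_left (by omega) hmem.1.ne')
  have hlt := (Nat.mul_lt_mul_left f.natDegree.factorial_pos).2 hpow
  have := Nat.factorial_mul_pow_le_factorial (m := f.natDegree) (n := g.natDegree)
  rw [hsum] at this
  omega

theorem aeval_ratPoly {n : ℕ} {a : Fin n → ℤ} {A : Type*} [CommRing A] [Algebra ℚ A] (x : A) :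
    aeval x (ratPoly n a) = aeval x (intPoly n a) :=
  aeval_map_algebraMap ℚ x (intPoly n a)

theorem minpoly_eq_ratPoly {n : ℕ} {a : Fin n → ℤ} (h : Irreducible (ratPoly n a))
    {K : Type*} [Field K] [Algebra ℚ K] {α : K} (hα : aeval α (intPoly n a) = 0) :
    minpoly ℚ α = ratPoly n a :=
  (minpoly.eq_of_irreducible_of_monic h (by rwa [aeval_ratPoly]) (monic_ratPoly n a)).symm

section Embeddings

variable {K : Type*} [Field K] [NumberField K]

/-- An integer all of whose conjugates are less than one in absolute value vanishes. -/
theorem eq_zero_of_norm_embeddings_lt_one {γ : K} (hγ : IsIntegral ℤ γ)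
    (h : ∀ σ : K →ₐ[ℚ] ℂ, ‖σ γ‖ < 1) : γ = 0 := by
  obtain ⟨z, hz⟩ := IsIntegrallyClosed.isIntegral_iff.1 (Algebra.isIntegral_norm ℚ hγ)
  have hprod := Algebra.norm_eq_prod_embeddings ℚ ℂ γ
  have hlt : ‖∏ σ : K →ₐ[ℚ] ℂ, σ γ‖ < 1 := by
    obtain ⟨σ₀⟩ : Nonempty (K →ₐ[ℚ] ℂ) := ⟨IsAlgClosed.lift⟩
    rw [norm_prod, ← Finset.mul_prod_erase _ _ (Finset.mem_univ σ₀)]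
    exact (mul_le_of_le_one_right (norm_nonneg _)
      (Finset.prod_le_one (fun _ _ => norm_nonneg _) fun σ _ => (h σ).le)).trans_lt (h σ₀)
  rw [← hprod, ← hz] at hlt
  have hz0 : z = 0 := by
    have : ‖(z : ℂ)‖ < 1 := by simpa using hlt
    rw [Complex.norm_intCast] at this
    exact Int.abs_lt_one_iff.1 (by exact_mod_cast this)
  rw [← Algebra.norm_eq_zero_iff (R := ℚ), ← hz, hz0, map_zero]

/-- A real coordinate of an element of a number field: the sum of the real and imaginary parts of
a conjugate. -/
def embCoord (σ : K →ₐ[ℚ] ℂ) (x : K) : ℝ := (σ x).re + (σ x).im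

theorem abs_embCoord_le (σ : K →ₐ[ℚ] ℂ) (x : K) : |embCoord σ x| ≤ 2 * ‖σ x‖ := by
  rw [two_mul]
  exact (abs_add_le _ _).trans (add_le_add (Complex.abs_re_le_norm _) (Complex.abs_im_le_norm _))

theorem eq_of_floor_embCoord_eq {α β : K} (hα : IsIntegral ℤ α) (hβ : IsIntegral ℤ β)
    (h : ∀ σ : K →ₐ[ℚ] ℂ, ⌊embCoord σ α⌋ = ⌊embCoord σ β⌋) : α = β := by
  refine sub_eq_zero.1 (eq_zero_of_norm_embeddings_lt_one (hα.sub hβ) fun σ => ?_)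
  have hlt : ∀ τ : K →ₐ[ℚ] ℂ, |embCoord τ (α - β)| < 1 := fun τ => by
    have : embCoord τ (α - β) = embCoord τ α - embCoord τ β := by
      simp only [embCoord, map_sub, Complex.sub_re, Complex.sub_im]
      ring
    rw [this]
    exact Int.abs_sub_lt_one_of_floor_eq_floor (h τ)
  have h1 := hlt σ
  have h2 := hlt (((Complex.conjAe.restrictScalars ℚ : ℂ ≃ₐ[ℚ] ℂ) : ℂ →ₐ[ℚ] ℂ).comp σ)
  have hconj : embCoord (((Complex.conjAe.restrictScalars ℚ : ℂ ≃ₐ[ℚ] ℂ) : ℂ →ₐ[ℚ] ℂ).comp σ)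
      (α - β) = (σ (α - β)).re - (σ (α - β)).im := by
    simp [embCoord]
    ring
  rw [hconj] at h2
  rw [embCoord] at h1
  rw [← sq_lt_one_iff₀ (norm_nonneg _), Complex.sq_norm, Complex.normSq_apply]
  rw [← sq_lt_one_iff_abs_lt_one] at h1 h2
  nlinarith

/-- The conjugates of a root of `f` are bounded by the coefficients of `f`, also on average. -/
theorem prod_max_one_norm_embeddings_le {n N : ℕ} (hN : 1 ≤ N) (hK : Module.finrank ℚ K = n)
    {a : Fin n → ℤ} (ha : a ∈ coeffBox n N) (hirr : Irreducible (ratPoly n a)) {α : K}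
    (hα : aeval α (intPoly n a) = 0) :
    ∏ σ : K →ₐ[ℚ] ℂ, max 1 ‖σ α‖ ≤ ((n + 1) * N : ℕ) := by
  let P : ℂ[X] := (intPoly n a).map (Int.castRingHom ℂ)
  have hPm : P.Monic := (monic_intPoly n a).map _
  have hPd : P.natDegree = n := by
    rw [(monic_intPoly n a).natDegree_map, natDegree_intPoly]
  have hinj : Function.Injective fun σ : K →ₐ[ℚ] ℂ => σ α := by
    rw [← Field.primitive_element_iff_algHom_eq_of_eval' ℚ ℂ (fun _ => IsAlgClosed.splits _),
      Field.primitive_element_iff_minpoly_natDegree_eq, minpoly_eq_ratPoly hirr hα,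
      natDegree_ratPoly, hK]
  have hroots : (Finset.univ : Finset (K →ₐ[ℚ] ℂ)).val.map (fun σ => σ α) = P.roots := by
    refine Multiset.eq_of_le_of_card_le ((Multiset.le_iff_subset
      ((Multiset.nodup_map_iff_of_injective hinj).2 Finset.univ.nodup)).2 fun x hx => ?_) ?_
    · obtain ⟨σ, -, rfl⟩ := Multiset.mem_map.1 hx
      rw [mem_roots hPm.ne_zero, IsRoot, eval_map, ← algebraMap_int_eq, ← aeval_def]
      have := congrArg (σ.restrictScalars ℤ) hα
      rwa [← aeval_algHom_apply, map_zero] at this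
    · rw [IsAlgClosed.card_roots_eq_natDegree, hPd, Multiset.card_map, Finset.card_val,
        Finset.card_univ, AlgHom.card, hK]
  have hmahler := mahlerMeasure_eq_leadingCoeff_mul_prod_roots P
  rw [hPm.leadingCoeff, norm_one, one_mul, ← hroots, Multiset.map_map] at hmahler
  refine (hmahler.symm.le).trans ((mahlerMeasure_le_sum_norm_coeff P).trans ?_)
  rw [sum_over_range' P (fun _ => norm_zero) (n + 1) (by omega)]
  have hcoeff : ∀ i ∈ Finset.range (n + 1), ‖P.coeff i‖ ≤ N := by
    intro i hi
    rcases (Nat.lt_succ_iff.1 (Finset.mem_range.1 hi)).eq_or_lt with rfl | hlt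
    · rw [← hPd, hPm.coeff_natDegree, norm_one]
      exact_mod_cast hN
    · have hi' := Finset.mem_Icc.1 (Fintype.mem_piFinset.1 ha ⟨i, hlt⟩)
      have : P.coeff i = (a ⟨i, hlt⟩ : ℂ) := by
        rw [coeff_map, ← coeff_intPoly n a ⟨i, hlt⟩]
        rfl
      rw [this, Complex.norm_intCast]
      exact_mod_cast abs_le.2 hi'
  refine (Finset.sum_le_card_nsmul _ _ _ hcoeff).trans (le_of_eq ?_)
  simp

theorem exists_embedding_forall_ne_norm_le {R : ℝ} (hR : 0 ≤ R) {α : K}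
    (h : ∏ σ : K →ₐ[ℚ] ℂ, max 1 ‖σ α‖ ≤ R) :
    (∀ σ : K →ₐ[ℚ] ℂ, ‖σ α‖ ≤ R) ∧
      ∃ σ₀ : K →ₐ[ℚ] ℂ, ∀ σ ≠ σ₀, ‖σ α‖ ≤ Real.sqrt R := by
  have hsub : ∀ s : Finset (K →ₐ[ℚ] ℂ), ∏ σ ∈ s, max 1 ‖σ α‖ ≤ R := fun s =>
    (Finset.prod_le_prod_of_subset_of_one_le (Finset.subset_univ s)
      (fun _ _ => by positivity) fun _ _ _ => le_max_left _ _).trans h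
  refine ⟨fun σ => (le_max_right 1 _).trans (by simpa using hsub {σ}), ?_⟩
  obtain ⟨σ₁⟩ : Nonempty (K →ₐ[ℚ] ℂ) := ⟨IsAlgClosed.lift⟩
  by_contra! hall
  obtain ⟨σ₂, -, h2⟩ := hall σ₁
  obtain ⟨σ₃, hne, h3⟩ := hall σ₂
  have hpair := hsub {σ₃, σ₂}
  rw [Finset.prod_pair hne] at hpair
  have h4 : Real.sqrt R * Real.sqrt R < max 1 ‖σ₃ α‖ * max 1 ‖σ₂ α‖ :=
    mul_lt_mul'' (h3.trans_le (le_max_right _ _)) (h2.trans_le (le_max_right _ _))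
      (Real.sqrt_nonneg _) (Real.sqrt_nonneg _)
  rw [Real.mul_self_sqrt hR] at h4
  linarith

theorem floor_mem_Icc_of_abs_le {x y : ℝ} {m : ℕ} (h : |x| ≤ 2 * y) (hy : y ≤ m) :
    ⌊x⌋ ∈ Finset.Icc (-(2 * m + 1 : ℕ) : ℤ) (2 * m + 1 : ℕ) := by
  obtain ⟨h1, h2⟩ := abs_le.1 h
  rw [Finset.mem_Icc]
  constructor
  · rw [Int.le_floor]
    push_cast
    linarith
  · refine Int.floor_le_iff.2 ?_
    push_cast
    linarith

/-- The number of irreducible polynomials with bounded coefficients that have a root in a given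
number field. -/
theorem card_filter_root_le {n N : ℕ} (hN : 1 ≤ N) (hK : Module.finrank ℚ K = n) :
    (((coeffBox n N).filter fun a => Irreducible (ratPoly n a) ∧
      ∃ α : K, aeval α (intPoly n a) = 0).card : ℝ) ≤
        n * (7 * ((n + 1) * N)) * (11 * Real.sqrt ((n + 1) * N)) ^ (n - 1) := by
  set A := (coeffBox n N).filter fun a => Irreducible (ratPoly n a) ∧
      ∃ α : K, aeval α (intPoly n a) = 0 with hA
  have hmem : ∀ a ∈ A, a ∈ coeffBox n N ∧ Irreducible (ratPoly n a) ∧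
      ∃ α : K, aeval α (intPoly n a) = 0 := fun a ha => Finset.mem_filter.1 ha
  choose! h1 h2 α hα using hmem
  set R : ℕ := (n + 1) * N with hRdef
  have hR1 : 1 ≤ R := Nat.mul_pos n.succ_pos hN
  let box : (K →ₐ[ℚ] ℂ) → Finset ((K →ₐ[ℚ] ℂ) → ℤ) := fun σ₀ => Fintype.piFinset fun σ =>
    if σ = σ₀ then Finset.Icc (-(2 * R + 1 : ℕ) : ℤ) (2 * R + 1 : ℕ)
    else Finset.Icc (-(2 * (Nat.sqrt R + 1) + 1 : ℕ) : ℤ) (2 * (Nat.sqrt R + 1) + 1 : ℕ)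
  have hbox : ∀ σ₀, (box σ₀).card = (4 * R + 3) * (4 * Nat.sqrt R + 7) ^ (n - 1) := by
    intro σ₀
    rw [Fintype.card_piFinset, ← Finset.mul_prod_erase _ _ (Finset.mem_univ σ₀),
      Finset.prod_congr rfl (g := fun _ => 4 * Nat.sqrt R + 7), Finset.prod_const,
      Finset.card_erase_of_mem (Finset.mem_univ _), Finset.card_univ, AlgHom.card, hK]
    · rw [if_pos rfl, Int.card_Icc]
      congr 1
      omega
    · intro σ hσ
      rw [if_neg (Finset.ne_of_mem_erase hσ), Int.card_Icc]
      omega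
  have hle : A.card ≤ (Finset.univ.biUnion box).card := by
    refine Finset.card_le_card_of_injOn (fun a σ => ⌊embCoord σ (α a)⌋) ?_ ?_
    · intro a ha
      have hprod := prod_max_one_norm_embeddings_le hN hK (h1 a ha) (h2 a ha) (hα a ha)
      obtain ⟨hall, σ₀, hσ₀⟩ := exists_embedding_forall_ne_norm_le (Nat.cast_nonneg _) hprod
      rw [Finset.mem_coe, Finset.mem_biUnion]
      refine ⟨σ₀, Finset.mem_univ _, Fintype.mem_piFinset.2 fun σ => ?_⟩
      split_ifs with h
      · exact floor_mem_Icc_of_abs_le (abs_embCoord_le σ _) (hall σ)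
      · exact floor_mem_Icc_of_abs_le (abs_embCoord_le σ _) ((hσ₀ σ h).trans
          (by exact_mod_cast Real.real_sqrt_le_nat_sqrt_succ))
    · intro a ha b hb hab
      have hintegral : ∀ c ∈ A, IsIntegral ℤ (α c) := fun c hc =>
        ⟨intPoly n c, monic_intPoly n c, hα c hc⟩
      have heq : α a = α b := eq_of_floor_embCoord_eq (hintegral a ha) (hintegral b hb) (congrFun hab)
      have hpoly : ratPoly n a = ratPoly n b := by
        rw [← minpoly_eq_ratPoly (h2 a ha) (hα a ha), heq, minpoly_eq_ratPoly (h2 b hb) (hα b hb)]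
      exact intPoly_injective n (map_injective _ (RingHom.injective_int _) hpoly)
  have hcard : A.card ≤ n * ((4 * R + 3) * (4 * Nat.sqrt R + 7) ^ (n - 1)) := by
    refine hle.trans ((Finset.card_biUnion_le_card_mul _ _ _ fun σ _ => (hbox σ).le).trans ?_)
    rw [Finset.card_univ, AlgHom.card, hK]
  have hRr : (1 : ℝ) ≤ R := by exact_mod_cast hR1
  have hs1 : 1 ≤ Real.sqrt R := Real.one_le_sqrt.2 hRr
  have hs : (Nat.sqrt R : ℝ) ≤ Real.sqrt R := Real.nat_sqrt_le_real_sqrt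
  have hRc : ((n : ℝ) + 1) * N = R := by rw [hRdef]; push_cast; ring
  rw [hRc, mul_assoc]
  refine (Nat.cast_le.2 hcard).trans ?_
  push_cast
  gcongr <;> linarith

end Embeddings

theorem exists_numberField_discr_eq_fieldDisc {n : ℕ} {a : Fin n → ℤ}
    (h : Irreducible (ratPoly n a)) :
    ∃ (K : Type) (_ : Field K) (_ : NumberField K), Module.finrank ℚ K = n ∧
      (∃ α : K, aeval α (intPoly n a) = 0) ∧ fieldDisc n a = NumberField.discr K := by
  have : Fact (Irreducible (ratPoly n a)) := ⟨h⟩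
  have : CharZero (AdjoinRoot (ratPoly n a)) :=
    charZero_of_injective_algebraMap (algebraMap ℚ (AdjoinRoot (ratPoly n a))).injective
  have : FiniteDimensional ℚ (AdjoinRoot (ratPoly n a)) :=
    PowerBasis.finite (AdjoinRoot.powerBasis h.ne_zero)
  refine ⟨AdjoinRoot (ratPoly n a), inferInstance, inferInstance, ?_,
    ⟨AdjoinRoot.root (ratPoly n a), ?_⟩, ?_⟩
  · exact (AdjoinRoot.powerBasis h.ne_zero).finrank.trans
      ((AdjoinRoot.powerBasis_dim h.ne_zero).trans (natDegree_ratPoly n a))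
  · have := AdjoinRoot.eval₂_root (ratPoly n a)
    rw [ratPoly, eval₂_map] at this
    rw [aeval_def]
    exact (eval₂_congr (RingHom.ext_int _ _) rfl rfl).trans this
  · rw [fieldDisc, dif_pos h]

theorem nonempty_algEquiv_of_minpoly_eq {F K K' : Type*} [Field F] [Field K] [Field K']
    [Algebra F K] [Algebra F K'] {α : K} {β : K'} (hα : IsIntegral F α) (hβ : IsIntegral F β)
    (hmin : minpoly F α = minpoly F β) (hα' : IntermediateField.adjoin F {α} = ⊤)
    (hβ' : IntermediateField.adjoin F {β} = ⊤) : Nonempty (K ≃ₐ[F] K') := by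
  have hgen : minpoly F (IntermediateField.adjoin.powerBasis hα).gen =
      minpoly F (IntermediateField.adjoin.powerBasis hβ).gen := by
    rw [IntermediateField.adjoin.powerBasis_gen, IntermediateField.adjoin.powerBasis_gen,
      IntermediateField.minpoly_gen, IntermediateField.minpoly_gen, hmin]
  exact ⟨IntermediateField.topEquiv.symm.trans <|
    (IntermediateField.equivOfEq hα'.symm).trans <| (PowerBasis.equivOfMinpoly _ _ hgen).trans <|
    (IntermediateField.equivOfEq hβ').trans IntermediateField.topEquiv⟩

section FieldGeneration

variable {K : Type*} [Field K] [NumberField K]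

theorem adjoin_root_eq_top {n : ℕ} (hK : Module.finrank ℚ K = n) {a : Fin n → ℤ}
    (h : Irreducible (ratPoly n a)) {α : K} (hα : aeval α (intPoly n a) = 0) :
    IntermediateField.adjoin ℚ {α} = ⊤ := by
  rw [Field.primitive_element_iff_minpoly_natDegree_eq, minpoly_eq_ratPoly h hα,
    natDegree_ratPoly, hK]

theorem nonempty_algEquiv_of_common_root {K' : Type*} [Field K'] [NumberField K'] {n : ℕ}
    (hK : Module.finrank ℚ K = n) (hK' : Module.finrank ℚ K' = n) {a : Fin n → ℤ}
    (h : Irreducible (ratPoly n a)) {α : K} (hα : aeval α (intPoly n a) = 0) {β : K'}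
    (hβ : aeval β (intPoly n a) = 0) : Nonempty (K ≃ₐ[ℚ] K') := by
  exact nonempty_algEquiv_of_minpoly_eq (.of_finite ℚ α) (.of_finite ℚ β)
    (by rw [minpoly_eq_ratPoly h hα, minpoly_eq_ratPoly h hβ])
    (adjoin_root_eq_top hK h hα) (adjoin_root_eq_top hK' h hβ)

open NumberField NumberField.mixedEmbedding NNReal ENNReal in
theorem minkowskiBound_lt_of_discr_le {D : ℕ} (hD : (discr K).natAbs ≤ D) :
    minkowskiBound K ↑1 <
      ((NNReal.sqrt D * 2 ^ Module.finrank ℚ K + 1 : ℝ≥0) : ℝ≥0∞) := by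
  refine lt_of_le_of_lt ?_ (ENNReal.coe_lt_coe.mpr (lt_add_one _))
  rw [minkowskiBound, volume_fundamentalDomain_fractionalIdealLatticeBasis,
    Units.val_one, FractionalIdeal.absNorm_one, Rat.cast_one,
    ENNReal.ofReal_one, one_mul, mixedEmbedding.finrank, volume_fundamentalDomain_latticeBasis,
    ENNReal.coe_mul, ENNReal.coe_pow, ENNReal.coe_ofNat,
    show (NNReal.sqrt D : ℝ≥0∞) = (1 : ℝ≥0∞) * NNReal.sqrt D by rw [one_mul]]
  gcongr
  · exact pow_le_one₀ (by positivity) (by simp)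
  · rw [← NNReal.coe_le_coe, coe_nnnorm, Int.norm_eq_abs, ← Int.cast_abs, Int.abs_eq_natAbs,
      Int.cast_natCast, NNReal.coe_natCast]
    exact Nat.cast_le.2 hD

open NumberField NumberField.mixedEmbedding NNReal ENNReal in
/-- A number field of small discriminant is generated by a small algebraic integer. -/
theorem exists_primitive_element_norm_le {n D : ℕ} (hK : Module.finrank ℚ K = n) (hn : 1 ≤ n)
    (hD : (discr K).natAbs ≤ D) :
    ∃ x : 𝓞 K, IntermediateField.adjoin ℚ {(x : K)} = ⊤ ∧
      ∀ φ : K →+* ℂ, ‖φ x‖ ≤ (2 ^ (n + 1) * D : ℕ) := by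
  have hD1 : 1 ≤ D := (Int.natAbs_pos.2 (discr_ne_zero K)).trans_le hD
  set B : ℝ≥0 := NNReal.sqrt D * 2 ^ n + 1 with hB
  have hmink : minkowskiBound K ↑1 < B := by
    rw [hB, ← hK]
    exact minkowskiBound_lt_of_discr_le hD
  have hle : (B : ℝ) + 1 ≤ (2 ^ (n + 1) * D : ℕ) := by
    have hDr : (1 : ℝ) ≤ D := by exact_mod_cast hD1
    have hs : Real.sqrt D ≤ D := (Real.sqrt_le_iff.2 ⟨by positivity, by nlinarith⟩)
    have h2 : (2 : ℝ) ≤ 2 ^ n := by simpa using pow_le_pow_right₀ (one_le_two (α := ℝ)) hn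
    rw [hB]
    push_cast
    rw [pow_succ]
    nlinarith [mul_le_mul_of_nonneg_right hs (by positivity : (0 : ℝ) ≤ 2 ^ n)]
  obtain ⟨w₀⟩ := (inferInstance : Nonempty (InfinitePlace K))
  by_cases hw₀ : w₀.IsReal
  · obtain ⟨x, hx, hlt⟩ := exists_primitive_element_lt_of_isReal K hw₀ (B := B) <|
      hmink.trans_le (le_mul_of_one_le_left zero_le (by exact_mod_cast one_le_convexBodyLTFactor K))
    refine ⟨x, hx, (InfinitePlace.le_iff_le (x : K) _).1 fun w => (hlt w).le.trans ?_⟩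
    refine le_trans ?_ hle
    push_cast
    exact max_le (by linarith) (by linarith [B.coe_nonneg])
  · obtain ⟨x, hx, hlt⟩ := exists_primitive_element_lt_of_isComplex K
      (InfinitePlace.not_isReal_iff_isComplex.1 hw₀) (B := B) <|
      hmink.trans_le
        (le_mul_of_one_le_left zero_le (by exact_mod_cast one_le_convexBodyLT'Factor K))
    refine ⟨x, hx, (InfinitePlace.le_iff_le (x : K) _).1 fun w => (hlt w).le.trans ?_⟩
    refine le_trans (Real.sqrt_le_iff.2 ⟨by positivity, ?_⟩) hle
    nlinarith [B.coe_nonneg]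

/-- A number field of small discriminant is generated by a root of a monic integer polynomial with
small coefficients. -/
theorem exists_mem_coeffBox_of_discr_le {n D : ℕ} (hK : Module.finrank ℚ K = n) (hn : 1 ≤ n)
    (hD : (NumberField.discr K).natAbs ≤ D) :
    ∃ b ∈ coeffBox n ((2 ^ (n + 2) * D) ^ n), Irreducible (ratPoly n b) ∧
      ∃ β : K, aeval β (intPoly n b) = 0 := by
  obtain ⟨x, hx, hnorm⟩ := exists_primitive_element_norm_le hK hn hD
  have hD1 : 1 ≤ D := (Int.natAbs_pos.2 (NumberField.discr_ne_zero K)).trans_le hD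
  have hintegral := x.isIntegral_coe
  have hmin := minpoly.isIntegrallyClosed_eq_field_fractions' ℚ hintegral
  have hdeg : (minpoly ℤ (x : K)).natDegree = n := by
    rw [Field.primitive_element_iff_minpoly_natDegree_eq, hmin,
      (minpoly.monic hintegral).natDegree_map, hK] at hx
    exact hx
  have hpoly := intPoly_coeff (minpoly.monic hintegral) hdeg
  refine ⟨fun i => (minpoly ℤ (x : K)).coeff i, ?_, ?_, x, ?_⟩
  · refine Fintype.mem_piFinset.2 fun i => ?_
    rw [Finset.mem_Icc, ← abs_le, ← @Int.cast_le ℝ]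
    refine (Eq.trans_le ?_ (NumberField.Embeddings.coeff_bdd_of_norm_le hnorm i)).trans ?_
    · rw [hmin, coeff_map, eq_intCast, Int.norm_cast_rat, Int.norm_eq_abs, Int.cast_abs]
    · have h1 : max (((2 ^ (n + 1) * D : ℕ) : ℝ)) 1 = (2 ^ (n + 1) * D : ℕ) :=
        max_eq_left (by exact_mod_cast Nat.mul_pos (by positivity) hD1)
      rw [h1, hK]
      have h2 : (2 ^ (n + 1) * D) ^ n * n.choose (n / 2) ≤ (2 ^ (n + 2) * D) ^ n := by
        refine (Nat.mul_le_mul_left _ (Nat.choose_le_two_pow n (n / 2))).trans (le_of_eq ?_)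
        rw [← mul_pow]
        ring
      exact_mod_cast h2
  · rw [ratPoly, hpoly]
    exact hmin ▸ minpoly.irreducible (hintegral.tower_top)
  · rw [hpoly]
    exact minpoly.aeval ℤ (x : K)

end FieldGeneration

theorem card_coeffBox (n H : ℕ) : (coeffBox n H).card = (2 * H + 1) ^ n := by
  rw [coeffBox, Fintype.card_piFinset_const, Int.card_Icc]
  congr 1
  omega

/-- The number of irreducible polynomials with coefficients of size at most `N` whose field has
discriminant at most `D`. -/
theorem card_filter_fieldDisc_le {n N D : ℕ} (hn : 1 ≤ n) (hN : 1 ≤ N) :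
    (((coeffBox n N).filter fun a => Irreducible (ratPoly n a) ∧
      (fieldDisc n a).natAbs ≤ D).card : ℝ) ≤
        (2 * (2 ^ (n + 2) * D) ^ n + 1) ^ n *
          (n * (7 * ((n + 1) * N)) * (11 * Real.sqrt ((n + 1) * N)) ^ (n - 1)) := by
  let A : (Fin n → ℤ) → Finset (Fin n → ℤ) := fun b => (coeffBox n N).filter fun a =>
    Irreducible (ratPoly n a) ∧ Irreducible (ratPoly n b) ∧
      ∃ (K : Type) (_ : Field K) (_ : NumberField K), Module.finrank ℚ K = n ∧
        (∃ α : K, aeval α (intPoly n a) = 0) ∧ ∃ β : K, aeval β (intPoly n b) = 0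
  have hA : ∀ b, ((A b).card : ℝ) ≤
      n * (7 * ((n + 1) * N)) * (11 * Real.sqrt ((n + 1) * N)) ^ (n - 1) := by
    intro b
    rcases (A b).eq_empty_or_nonempty with h | ⟨a₀, ha₀⟩
    · rw [h, Finset.card_empty, Nat.cast_zero]
      positivity
    obtain ⟨-, -, hb, K, _, _, hK, -, β, hβ⟩ := Finset.mem_filter.1 ha₀
    refine le_trans (Nat.cast_le.2 (Finset.card_le_card fun a ha => ?_))
      (card_filter_root_le (K := K) hN hK)
    obtain ⟨hbox, ha, -, K', _, _, hK', ⟨α, hα⟩, β', hβ'⟩ := Finset.mem_filter.1 ha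
    obtain ⟨e⟩ := nonempty_algEquiv_of_common_root hK' hK hb hβ' hβ
    refine Finset.mem_filter.2 ⟨hbox, ha, e α, ?_⟩
    have := congrArg e hα
    rw [map_zero, ← aeval_ratPoly, ← AlgEquiv.coe_toAlgHom, ← aeval_algHom_apply,
      aeval_ratPoly] at this
    exact this
  have hsub : ((coeffBox n N).filter fun a => Irreducible (ratPoly n a) ∧
      (fieldDisc n a).natAbs ≤ D) ⊆ (coeffBox n ((2 ^ (n + 2) * D) ^ n)).biUnion A := by
    intro a ha
    obtain ⟨hbox, hirr, hdisc⟩ := Finset.mem_filter.1 ha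
    obtain ⟨K, iF, iN, hK, hα, hd⟩ := exists_numberField_discr_eq_fieldDisc hirr
    obtain ⟨b, hb, hbirr, hβ⟩ := exists_mem_coeffBox_of_discr_le hK hn (hd ▸ hdisc)
    exact Finset.mem_biUnion.2
      ⟨b, hb, Finset.mem_filter.2 ⟨hbox, hirr, hbirr, K, iF, iN, hK, hα, hβ⟩⟩
  have hcard := card_coeffBox n ((2 ^ (n + 2) * D) ^ n)
  calc _ ≤ (((coeffBox n ((2 ^ (n + 2) * D) ^ n)).biUnion A).card : ℝ) := by
        exact_mod_cast Finset.card_le_card hsub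
    _ ≤ ∑ b ∈ coeffBox n ((2 ^ (n + 2) * D) ^ n), ((A b).card : ℝ) := by
        exact_mod_cast Finset.card_biUnion_le
    _ ≤ _ := (Finset.sum_le_card_nsmul _ _ _ fun b _ => hA b).trans
        (by rw [nsmul_eq_mul, hcard]; push_cast; rfl)

theorem tendsto_one_div_sqrt_log_log :
    Tendsto (fun N : ℕ => 1 / Real.sqrt (Real.log (Real.log (N : ℝ)))) atTop (nhds 0) := by
  simp_rw [one_div]
  exact tendsto_inv_atTop_zero.comp (Real.tendsto_sqrt_atTop.comp
    (Real.tendsto_log_atTop.comp (Real.tendsto_log_atTop.comp tendsto_natCast_atTop_atTop)))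

/-- If the discriminant bound `D` is at most `N ^ (1 / (4 * n ^ 2))`, the number of irreducible
polynomials in the box whose field has discriminant at most `D` is `O(N ^ (n - 1 / 4))`. -/
theorem exists_card_filter_fieldDisc_le_rpow {n : ℕ} (hn : 2 ≤ n) :
    ∃ C : ℝ, ∀ N D : ℕ, 1 ≤ N → (D : ℝ) ≤ (N : ℝ) ^ (1 / (4 * (n : ℝ) ^ 2)) →
      (((coeffBox n N).filter fun a => Irreducible (ratPoly n a) ∧
        (fieldDisc n a).natAbs ≤ D).card : ℝ) ≤ C * (N : ℝ) ^ n / (N : ℝ) ^ (1 / 4 : ℝ) := by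
  obtain ⟨m, rfl⟩ := Nat.exists_eq_add_of_le' hn
  set n := m + 2 with hnm
  refine ⟨(3 * (2 ^ (n + 2)) ^ n) ^ n *
    (n * (7 * (n + 1)) * (11 * Real.sqrt (n + 1)) ^ (m + 1)), fun N D hN hD => ?_⟩
  have hN1 : (1 : ℝ) ≤ N := by exact_mod_cast hN
  have hN0 : (0 : ℝ) ≤ N := by positivity
  set t : ℝ := (N : ℝ) ^ (1 / 4 : ℝ) with ht
  have ht1 : 1 ≤ t := Real.one_le_rpow hN1 (by norm_num)
  have ht4 : (N : ℝ) = t ^ 4 := by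
    rw [ht, ← Real.rpow_mul_natCast hN0]
    norm_num
  have hsqrt : Real.sqrt N = t ^ 2 := by
    rw [ht4, show t ^ 4 = (t ^ 2) ^ 2 by ring, Real.sqrt_sq (by positivity)]
  set Y : ℝ := (N : ℝ) ^ (1 / (4 * (n : ℝ) ^ 2)) with hY
  have hY1 : 1 ≤ Y := Real.one_le_rpow hN1 (by positivity)
  have hYt : (Y ^ n) ^ n = t := by
    rw [← pow_mul, hY, ht, ← Real.rpow_mul_natCast hN0]
    congr 1
    have : (n : ℝ) ≠ 0 := by positivity
    push_cast
    field_simp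
  have hbase : (2 * (2 ^ (n + 2) * (D : ℝ)) ^ n + 1) ^ n ≤ (3 * (2 ^ (n + 2)) ^ n) ^ n * t := by
    have h1 : (1 : ℝ) ≤ (2 ^ (n + 2) * Y) ^ n :=
      one_le_pow₀ (one_le_mul_of_one_le_of_one_le (one_le_pow₀ one_le_two) hY1)
    calc (2 * (2 ^ (n + 2) * (D : ℝ)) ^ n + 1) ^ n
        ≤ (2 * (2 ^ (n + 2) * Y) ^ n + (2 ^ (n + 2) * Y) ^ n) ^ n := by gcongr
      _ = (3 * (2 ^ (n + 2)) ^ n) ^ n * (Y ^ n) ^ n := by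
        rw [← mul_pow]
        congr 1
        rw [mul_pow]
        ring
      _ = _ := by rw [hYt]
  refine (card_filter_fieldDisc_le (by omega) hN).trans ?_
  rw [show n - 1 = m + 1 by omega, Real.sqrt_mul (by positivity), hsqrt,
    le_div_iff₀ (by positivity)]
  have hpow : t ^ (2 * m + 8) ≤ t ^ (4 * m + 8) := pow_le_pow_right₀ ht1 (by omega)
  calc _ ≤ ((3 * (2 ^ (n + 2)) ^ n) ^ n * t) * (n * (7 * ((n + 1) * N)) *
        (11 * (Real.sqrt (n + 1) * t ^ 2)) ^ (m + 1)) * t := by gcongr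
    _ = (3 * (2 ^ (n + 2)) ^ n) ^ n * (n * (7 * (n + 1)) *
        (11 * Real.sqrt (n + 1)) ^ (m + 1)) * t ^ (2 * m + 8) := by
      rw [← mul_assoc 11, mul_pow _ (t ^ 2), ht4]
      ring
    _ ≤ (3 * (2 ^ (n + 2)) ^ n) ^ n * (n * (7 * (n + 1)) *
        (11 * Real.sqrt (n + 1)) ^ (m + 1)) * t ^ (4 * m + 8) := by gcongr
    _ = _ := by
      rw [ht4, ← pow_mul t 4 n, hnm, show 4 * (m + 2) = 4 * m + 8 by ring]

/-- **Lemma 5.4**: the density of `f ∈ 𝒫⁰_{n,N}` with `D_{ℚ_f} ≤ N^{1/√(log log N)}`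
tends to zero as `N → ∞`. -/
theorem density_small_discriminant (n : ℕ) (hn : 2 ≤ n) :
    Tendsto (fun N : ℕ =>
        (((P0 n N).filter fun f =>
            (((fieldDisc n f).natAbs : ℝ)) ≤
              (N : ℝ) ^ (1 / Real.sqrt (Real.log (Real.log (N : ℝ))))).card : ℝ) /
          ((P0 n N).card : ℝ))
      atTop (nhds 0) := by
  obtain ⟨c, hc, hlow⟩ := exists_mul_pow_le_card_P0 hn
  obtain ⟨C, hC⟩ := exists_card_filter_fieldDisc_le_rpow hn
  have hε : (0 : ℝ) < 1 / (4 * (n : ℝ) ^ 2) := by positivity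
  have hlim : Tendsto (fun N : ℕ => C / c * ((N : ℝ) ^ (1 / 4 : ℝ))⁻¹) atTop (nhds 0) := by
    simpa using (tendsto_inv_atTop_zero.comp ((tendsto_rpow_atTop (by norm_num :
      (0 : ℝ) < 1 / 4)).comp tendsto_natCast_atTop_atTop)).const_mul (C / c)
  refine squeeze_zero' (.of_forall fun N => by positivity) ?_ hlim
  filter_upwards [hlow, tendsto_one_div_sqrt_log_log.eventually_le_const hε,
    eventually_ge_atTop 1] with N hlowN hexp hN
  have hN1 : (1 : ℝ) ≤ N := by exact_mod_cast hN
  have hX := Real.rpow_le_rpow_of_exponent_le hN1 hexp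
  set X : ℝ := (N : ℝ) ^ (1 / Real.sqrt (Real.log (Real.log (N : ℝ))))
  have hX0 : 0 ≤ X := by positivity
  have hup : (((P0 n N).filter fun f => (((fieldDisc n f).natAbs : ℝ)) ≤ X).card : ℝ) ≤
      C * (N : ℝ) ^ n / (N : ℝ) ^ (1 / 4 : ℝ) := by
    refine le_trans ?_ (hC N ⌊X⌋₊ hN ((Nat.floor_le hX0).trans hX))
    refine Nat.cast_le.2 (Finset.card_le_card fun a ha => ?_)
    obtain ⟨haP, haX⟩ := Finset.mem_filter.1 ha
    obtain ⟨hbox, hSn⟩ := Finset.mem_filter.1 haP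
    exact Finset.mem_filter.2 ⟨hbox, hSn.irreducible hn, Nat.le_floor haX⟩
  calc _ ≤ (C * (N : ℝ) ^ n / (N : ℝ) ^ (1 / 4 : ℝ)) / (c * (N : ℝ) ^ n) :=
        div_le_div₀ ((Nat.cast_nonneg _).trans hup) hup (by positivity) hlowN
    _ = _ := by field_simp

end
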